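/- For every game G, every K ∈ ℤ+, and all S, T ∈ ℕ, the non-uniform security of the salted game satisfies the multiplicative bound ε_{G_K}(S, T) ≤ 2·ε_G(T) + 2S/K. -/

import Mathlib

open scoped ENNReal BigOperators

noncomputable section

/-- `{0,1}`-valued indicator of a proposition, in `ℝ≥0∞`. -/
def ind (p : Prop) : ℝ≥0∞ :=
  haveI := Classical.propDecidable p
  if p then 1 else 0

/-- Deterministic oracle algorithms making at most `T` queries, modeled as decision
trees of depth at most `T`: a query is an element `q : Q`, the oracle's answer to `q`
has type `Ans q`, and the final output has type `O`. -/
inductive DT (Q : Type) (Ans : Q → Type) (O : Type) : ℕ → Type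
  | ret {T : ℕ} (o : O) : DT Q Ans O T
  | query {T : ℕ} (q : Q) (cont : Ans q → DT Q Ans O T) : DT Q Ans O (T + 1)

/-- Run a decision tree against an oracle. -/
def DT.run {Q : Type} {Ans : Q → Type} {O : Type} :
    {T : ℕ} → DT Q Ans O T → ((q : Q) → Ans q) → O
  | _, DT.ret o, _ => o
  | _, DT.query q cont, f => DT.run (cont (f q)) f

/-- The number of queries satisfying `p` made along the execution path on oracle `f`. -/
def DT.countP {Q : Type} {Ans : Q → Type} {O : Type} (p : Q → Prop) :
    {T : ℕ} → DT Q Ans O T → ((q : Q) → Ans q) → ℕ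
  | _, DT.ret _, _ => 0
  | _, DT.query q cont, f =>
      (haveI := Classical.propDecidable (p q); if p q then 1 else 0)
        + DT.countP p (cont (f q)) f

/-- A (single-challenge) game: an oracle distribution `μ` over functions
`Fin M → Fin N`, a challenge distribution `π f` for each oracle `f`, and an
accepting outcome set `R f ch` for each oracle and challenge. -/
structure Game where
  M : ℕ
  N : ℕ
  hM : 0 < M
  hN : 0 < N
  Ch : Type
  chFin : Fintype Ch
  Out : Type
  μ : PMF (Fin M → Fin N)
  π : (Fin M → Fin N) → PMF Ch
  R : (Fin M → Fin N) → Ch → Set Out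

attribute [instance] Game.chFin

namespace Game

variable (G : Game)

/-- Winning probability of a deterministic `T`-query algorithm (taking the challenge
as classical input) for the game `G`. -/
def detWinProb {T : ℕ} (a : G.Ch → DT (Fin G.M) (fun _ => Fin G.N) G.Out T) : ℝ≥0∞ :=
  ∑' f : Fin G.M → Fin G.N, G.μ f * ∑' ch : G.Ch, G.π f ch * ind ((a ch).run f ∈ G.R f ch)

/-- Uniform security `ε_G(T)`: the supremum, over randomized `T`-query algorithms
(probability distributions over deterministic ones), of the winning probability. -/
def unifSec (T : ℕ) : ℝ≥0∞ :=
  ⨆ A : PMF (G.Ch → DT (Fin G.M) (fun _ => Fin G.N) G.Out T),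
    ∑' a, A a * G.detWinProb a

/-- Winning probability, in the salted game `G_K`, of a non-uniform algorithm:
a randomized `T`-query algorithm `A` receiving `S` bits of advice together with the
salt and challenge, and an advice function `adv` mapping the joint oracle to `S` bits.
The joint oracle consists of `K` i.i.d. copies `g 0, …, g (K-1)` of the oracle of `G`,
the salt `k` is uniform on `Fin K` and the challenge is drawn from `π (g k)`. -/
def saltedWinProb (K S T : ℕ)
    (A : PMF ((Fin S → Bool) × Fin K × G.Ch →
      DT (Fin K × Fin G.M) (fun _ => Fin G.N) G.Out T))
    (adv : (Fin K → Fin G.M → Fin G.N) → Fin S → Bool) : ℝ≥0∞ :=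
  ∑' g : Fin K → Fin G.M → Fin G.N,
    (∏ k, G.μ (g k)) *
      ((K : ℝ≥0∞)⁻¹ *
        ∑' k : Fin K, ∑' ch : G.Ch, G.π (g k) ch *
          ∑' a, A a *
            ind ((a (adv g, k, ch)).run (fun q => g q.1 q.2) ∈ G.R (g k) ch))

/-- Non-uniform security `ε_{G_K}(S,T)` of the salted game `G_K`: the supremum of the
winning probability over all non-uniform `(S,T)`-algorithms `(A, adv)`. -/
def saltedNonunifSec (K S T : ℕ) : ℝ≥0∞ :=
  ⨆ (A : PMF ((Fin S → Bool) × Fin K × G.Ch →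
      DT (Fin K × Fin G.M) (fun _ => Fin G.N) G.Out T))
    (adv : (Fin K → Fin G.M → Fin G.N) → Fin S → Bool),
    G.saltedWinProb K S T A adv

/-- The marginal probability of a challenge `ch` (for `f ∼ μ`, `ch ∼ π f`). -/
def chProb (ch : G.Ch) : ℝ≥0∞ := ∑' f : Fin G.M → Fin G.N, G.μ f * G.π f ch

/-- The oracle distribution `μ_ch` conditioned on the drawn challenge being `ch`. -/
def condDist (ch : G.Ch) (f : Fin G.M → Fin G.N) : ℝ≥0∞ :=
  G.μ f * G.π f ch / G.chProb ch

/-- Uniform security `ε_{G_ch}(T)` of the challenge-conditioned plain game `G_ch`: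
the supremum over randomized `T`-query algorithms of the probability, for
`f ∼ μ_ch`, that the output lies in `R f ch`. -/
def condSec (ch : G.Ch) (T : ℕ) : ℝ≥0∞ :=
  ⨆ A : PMF (DT (Fin G.M) (fun _ => Fin G.N) G.Out T),
    ∑' a, A a * ∑' f : Fin G.M → Fin G.N, G.condDist ch f * ind (a.run f ∈ G.R f ch)

/-- Uniform security `ε_{G^n}(T')` of the multi-challenge game `G^n`: `n` i.i.d.
challenges are drawn from `π f` and the algorithm must answer all of them. -/
def multiSec (n T' : ℕ) : ℝ≥0∞ :=
  ⨆ A : PMF ((Fin n → G.Ch) → DT (Fin G.M) (fun _ => Fin G.N) (Fin n → G.Out) T'),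
    ∑' a, A a * ∑' f : Fin G.M → Fin G.N, G.μ f *
      ∑' chs : Fin n → G.Ch,
        (∏ j, G.π f (chs j)) * ind (∀ j, (a chs).run f j ∈ G.R f (chs j))

end Game

/-- A plain game: a game without challenges. -/
structure PlainGame where
  M : ℕ
  N : ℕ
  hM : 0 < M
  hN : 0 < N
  Out : Type
  μ : PMF (Fin M → Fin N)
  R : (Fin M → Fin N) → Set Out

namespace PlainGame

/-- Uniform security `ε_G(T)` of a plain game. -/
def unifSec (G : PlainGame) (T : ℕ) : ℝ≥0∞ :=
  ⨆ A : PMF (DT (Fin G.M) (fun _ => Fin G.N) G.Out T),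
    ∑' a, A a * ∑' f : Fin G.M → Fin G.N, G.μ f * ind (a.run f ∈ G.R f)

end PlainGame

/-- Query domain for joint oracle access to the oracles of `k` plain games:
each query is addressed to one of the oracles. -/
abbrev ProdQ {k : ℕ} (Gs : Fin k → PlainGame) : Type := (i : Fin k) × Fin (Gs i).M

/-- Answer type for queries in the direct product. -/
abbrev ProdAns {k : ℕ} (Gs : Fin k → PlainGame) : ProdQ Gs → Type :=
  fun q => Fin (Gs q.1).N

/-- The joint oracle `(f 0, …, f (k-1))` as a single oracle function. -/
def jointOracle {k : ℕ} {Gs : Fin k → PlainGame}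
    (f : (i : Fin k) → Fin (Gs i).M → Fin (Gs i).N) : (q : ProdQ Gs) → ProdAns Gs q :=
  fun q => f q.1 q.2

/-- Winning probability of a `(T 0, …, T (k-1))`-memoryless algorithm, given by
deterministic algorithms `A i` (each making at most `T i` queries and each with
joint oracle access) run sequentially with no shared memory; the oracles are drawn
independently, and the algorithm wins if every output `(A i).run` is accepted. -/
def memorylessWinProb {k : ℕ} (Gs : Fin k → PlainGame) {T : Fin k → ℕ}
    (A : (i : Fin k) → DT (ProdQ Gs) (ProdAns Gs) (Gs i).Out (T i)) : ℝ≥0∞ :=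
  ∑' f : (i : Fin k) → Fin (Gs i).M → Fin (Gs i).N,
    (∏ i, (Gs i).μ (f i)) * ind (∀ i, (A i).run (jointOracle f) ∈ (Gs i).R (f i))

/-- Winning probability of a deterministic algorithm with joint oracle access
outputting a tuple `(e 0, …, e (k-1))` for the direct product game. -/
def jointWinProb {k : ℕ} (Gs : Fin k → PlainGame) {B : ℕ}
    (A : DT (ProdQ Gs) (ProdAns Gs) ((i : Fin k) → (Gs i).Out) B) : ℝ≥0∞ :=
  ∑' f : (i : Fin k) → Fin (Gs i).M → Fin (Gs i).N,
    (∏ i, (Gs i).μ (f i)) * ind (∀ i, A.run (jointOracle f) i ∈ (Gs i).R (f i))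

/-- A deterministic algorithm is `(T 0, …, T (k-1))`-fair if in every execution it
makes at most `T i` queries to the `i`-th oracle. -/
def IsFair {k : ℕ} {Gs : Fin k → PlainGame} {O : Type} {B : ℕ} (T : Fin k → ℕ)
    (A : DT (ProdQ Gs) (ProdAns Gs) O B) : Prop :=
  ∀ (f : (i : Fin k) → Fin (Gs i).M → Fin (Gs i).N) (i : Fin k),
    A.countP (fun q => q.1 = i) (jointOracle f) ≤ T i

end

/-- Restrict a weight `W` to the oracles `f` with `ρ f = y`. -/
noncomputable def restrictWeight {F O B : Type} (W : F → O → ℝ≥0∞) (ρ : F → B) (y : B) :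
    F → O → ℝ≥0∞ :=
  fun f o => ind (ρ f = y) * W f o

namespace DT

variable {ι Q B O : Type}

/-- The best total weight collected by a decision tree of depth at most `T`. -/
noncomputable def value [Fintype Q] [DecidableEq Q] [Fintype B]
    (W : (Q → B) → O → ℝ≥0∞) (T : ℕ) : ℝ≥0∞ :=
  ⨆ d : DT Q (fun _ => B) O T, ∑ f, W f (d.run f)

/-- A decision tree together with its depth bound. -/
abbrev Bundled (Q B O : Type) : Type := Σ T, DT Q (fun _ => B) O T

/-- The first query of a decision tree, if there is one. -/
def Bundled.head : Bundled Q B O → Option Q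
  | ⟨_, ret _⟩ => none
  | ⟨_, query q _⟩ => some q

/-- The subtree reached when the first query is answered by `y`. -/
def Bundled.next (y : B) : Bundled Q B O → Bundled Q B O
  | ⟨T, ret o⟩ => ⟨T, ret o⟩
  | ⟨_, query _ c⟩ => ⟨_, c y⟩

/-- Bound on the weight collected by a player following the tree `A`, which may address
oracles other than the player's own: the value of the game if queries remain, and the
exact weight of the output otherwise. -/
noncomputable def Bundled.bound [Fintype Q] [DecidableEq Q] [Fintype B]
    (W : (Q → B) → O → ℝ≥0∞) : Bundled (ι × Q) B O → ℝ≥0∞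
  | ⟨_, ret o⟩ => ∑ f, W f o
  | ⟨T + 1, query _ _⟩ => value W (T + 1)

theorem sum_iSup_le_iSup_sum {α D : Type} [Nonempty D] (s : Finset α)
    (F : α → D → ℝ≥0∞) :
    ∑ i ∈ s, ⨆ d, F i d ≤ ⨆ a : α → D, ∑ i ∈ s, F i (a i) := by
  classical
  induction s using Finset.induction_on with
  | empty => simp
  | insert i s hi ih =>
    rw [Finset.sum_insert hi]
    refine (add_le_add_right ih _).trans (ENNReal.iSup_add_iSup_le fun d a => ?_)
    refine le_iSup_of_le (Function.update a i d) ?_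
    rw [Finset.sum_insert hi, Function.update_self]
    refine add_le_add_right (Finset.sum_le_sum fun j hj => ?_) _
    rw [Function.update_of_ne (ne_of_mem_of_not_mem hj hi)]

theorem sum_restrictWeight {F : Type} [Fintype B] (W : F → O → ℝ≥0∞) (ρ : F → B)
    (f : F) (o : B → O) :
    ∑ y, restrictWeight W ρ y f (o y) = W f (o (ρ f)) := by
  rw [Finset.sum_eq_single (ρ f)]
  · simp [restrictWeight, ind]
  · intro y _ hy
    simp [restrictWeight, ind, hy.symm]
  · simp

theorem sum_restrictWeight_const {F : Type} [Fintype B] (W : F → O → ℝ≥0∞) (b : B)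
    (Φ : (F → O → ℝ≥0∞) → ℝ≥0∞) (h0 : Φ (fun _ _ => 0) = 0) :
    ∑ y, Φ (restrictWeight W (fun _ => b) y) = Φ W := by
  rw [Finset.sum_eq_single b]
  · congr 1
    ext f o
    simp [restrictWeight, ind]
  · intro y _ hy
    rw [← h0]
    congr 1
    ext f o
    simp [restrictWeight, ind, hy.symm]
  · simp

/-- A tree viewed with a larger depth bound. -/
theorem exists_run_eq_succ {T : ℕ} (d : DT Q (fun _ => B) O T) :
    ∃ d' : DT Q (fun _ => B) O (T + 1), ∀ f, d'.run f = d.run f := by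
  induction d with
  | ret o => exact ⟨ret o, fun f => rfl⟩
  | query q c ih =>
    choose c' hc' using ih
    exact ⟨query q c', fun f => hc' _ f⟩

section

variable [Fintype Q] [DecidableEq Q] [Fintype B]

theorem value_le_value_succ (W : (Q → B) → O → ℝ≥0∞) (T : ℕ) :
    value W T ≤ value W (T + 1) := by
  refine iSup_le fun d => ?_
  obtain ⟨d', hd'⟩ := exists_run_eq_succ d
  exact le_iSup_of_le d' (by simp [hd'])

theorem value_zero (T : ℕ) : value (fun (_ : Q → B) (_ : O) => 0) T = 0 := by
  simp [value]

theorem sum_value_restrictWeight_le [Nonempty O] (W : (Q → B) → O → ℝ≥0∞) (q : Q) (T : ℕ) :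
    ∑ y, value (restrictWeight W (fun f => f q) y) T ≤ value W (T + 1) := by
  have : Nonempty (DT Q (fun _ => B) O T) := ⟨ret (Classical.arbitrary O)⟩
  refine (sum_iSup_le_iSup_sum _ _).trans (iSup_le fun c => ?_)
  refine le_iSup_of_le (query q c) ?_
  rw [Finset.sum_comm]
  refine Finset.sum_le_sum fun f _ => ?_
  rw [sum_restrictWeight W (fun f => f q) f (fun y => (c y).run f)]
  rfl

theorem sum_le_value (W : (Q → B) → O → ℝ≥0∞) (o : O) (T : ℕ) :
    ∑ f, W f o ≤ value W T :=
  le_iSup_of_le (ret o) le_rfl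

theorem Bundled.bound_le_value (W : (Q → B) → O → ℝ≥0∞) (A : Bundled (ι × Q) B O) :
    A.bound W ≤ value W A.1 := by
  rcases A with ⟨T, _ | _⟩
  · exact sum_le_value W _ _
  · exact le_rfl

theorem Bundled.bound_zero (A : Bundled (ι × Q) B O) :
    A.bound (fun (_ : Q → B) _ => 0) = 0 := by
  rcases A with ⟨T, _ | _⟩
  · simp [bound]
  · exact value_zero _

end

theorem Bundled.run_next {A : Bundled Q B O} {q : Q} (h : A.head = some q) (f : Q → B) :
    (A.next (f q)).2.run f = A.2.run f := by
  rcases A with ⟨T, _ | ⟨q', c⟩⟩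
  · simp [head] at h
  · obtain rfl : q' = q := by simpa [head] using h
    rfl

theorem Bundled.next_fst {A : Bundled Q B O} {q : Q} (h : A.head = some q) (y : B) :
    A.1 = (A.next y).1 + 1 := by
  rcases A with ⟨T, _ | _⟩
  · simp [head] at h
  · rfl

variable [Fintype ι] [DecidableEq ι] [Fintype Q] [DecidableEq Q] [Fintype B]

/-- Reveal simultaneously the answers to the first queries of the players in `C`, when at most
one point `p i` per oracle is revealed, and only in oracles `i ∈ D` whose player is
in `C` or has finished. -/
theorem sum_prod_le_of_reveal [Nonempty B] [Nonempty O]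
    (W : ι → (Q → B) → O → ℝ≥0∞) (A : ι → Bundled (ι × Q) B O)
    (C D : Set ι) (p : ι → Q) (σ : ι → ι)
    (hhead : ∀ i ∈ C, (A i).head = some (σ i, p (σ i)))
    (hσ : ∀ i ∈ C, σ i ∈ D) (hD : ∀ i ∈ D, i ∉ C → (A i).head = none)
    (hC : C.Nonempty)
    (ih : ∀ (W' : ι → (Q → B) → O → ℝ≥0∞) (A' : ι → Bundled (ι × Q) B O),
      ∑ i, (A' i).1 < ∑ i, (A i).1 →
      ∑ g : ι → Q → B, ∏ i, W' i (g i) ((A' i).2.run fun q => g q.1 q.2)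
        ≤ ∏ i, (A' i).bound (W' i)) :
    ∑ g : ι → Q → B, ∏ i, W i (g i) ((A i).2.run fun q => g q.1 q.2)
      ≤ ∏ i, (A i).bound (W i) := by
  classical
  let ρ : ι → (Q → B) → B := fun i f => if i ∈ D then f (p i) else Classical.arbitrary B
  let A' : (ι → B) → ι → Bundled (ι × Q) B O :=
    fun y i => if i ∈ C then (A i).next (y (σ i)) else A i
  let β : ι → B → ℝ≥0∞ := fun i y =>
    if i ∈ C then value (restrictWeight (W i) (ρ i) y) ((A i).1 - 1)
    else (A i).bound (restrictWeight (W i) (ρ i) y)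
  have hA'fst : ∀ y, ∀ i ∈ C, (A i).1 = (A' y i).1 + 1 := fun y i hi => by
    simpa [A', hi] using Bundled.next_fst (hhead i hi) _
  have hsplit : ∀ g : ι → Q → B,
      ∏ i, W i (g i) ((A i).2.run fun q => g q.1 q.2) =
        ∑ y : ι → B, ∏ i, restrictWeight (W i) (ρ i) (y i) (g i)
          ((A' y i).2.run fun q => g q.1 q.2) := by
    intro g
    rw [Finset.sum_eq_single (fun i => ρ i (g i))]
    · refine Finset.prod_congr rfl fun i _ => ?_
      have hrun : (A' (fun i => ρ i (g i)) i).2.run (fun q => g q.1 q.2)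
          = (A i).2.run fun q => g q.1 q.2 := by
        by_cases hi : i ∈ C
        · have hA' : A' (fun i => ρ i (g i)) i = (A i).next (g (σ i) (p (σ i))) := by
            simp [A', hi, ρ, hσ i hi]
          rw [hA']
          exact Bundled.run_next (hhead i hi) fun q => g q.1 q.2
        · have hA' : A' (fun i => ρ i (g i)) i = A i := by simp [A', hi]
          rw [hA']
      rw [hrun]
      simp [restrictWeight, ind]
    · intro y _ hy
      obtain ⟨i, hi⟩ := Function.ne_iff.1 hy
      refine Finset.prod_eq_zero (Finset.mem_univ i) ?_
      simp [restrictWeight, ind, hi.symm]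
    · simp
  have hβ : ∀ i, ∑ y, β i y ≤ (A i).bound (W i) := by
    intro i
    by_cases hi : i ∈ C
    · have hh := hhead i hi
      simp only [β, hi, if_true]
      generalize A i = Ai at hh
      rcases Ai with ⟨_, _ | @⟨T, q, c⟩⟩
      · simp [Bundled.head] at hh
      · by_cases hiD : i ∈ D
        · simpa [ρ, hiD, Bundled.bound] using sum_value_restrictWeight_le (W i) (p i) T
        · simp only [ρ, hiD, if_false]
          rw [sum_restrictWeight_const _ _ (fun W => value W _) (value_zero _)]
          exact value_le_value_succ _ _
    · simp only [β, hi, if_false]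
      by_cases hiD : i ∈ D
      · have hh := hD i hiD hi
        generalize A i = Ai at hh
        rcases Ai with ⟨_, o | _⟩
        · simp only [Bundled.bound]
          rw [Finset.sum_comm]
          exact (Finset.sum_congr rfl fun f _ =>
            sum_restrictWeight (W i) (ρ i) f (fun _ => o)).le
        · simp [Bundled.head] at hh
      · simp only [ρ, hiD, if_false]
        rw [sum_restrictWeight_const _ _ (fun W => (A i).bound W) (A i).bound_zero]
  calc ∑ g : ι → Q → B, ∏ i, W i (g i) ((A i).2.run fun q => g q.1 q.2)
      = ∑ y : ι → B, ∑ g : ι → Q → B, ∏ i, restrictWeight (W i) (ρ i) (y i) (g i)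
          ((A' y i).2.run fun q => g q.1 q.2) := by
        rw [Finset.sum_comm]
        exact Finset.sum_congr rfl fun g _ => hsplit g
    _ ≤ ∑ y : ι → B, ∏ i, β i (y i) := by
        refine Finset.sum_le_sum fun y _ => ?_
        refine (ih _ (A' y) ?_).trans (Finset.prod_le_prod' fun i _ => ?_)
        · obtain ⟨j, hj⟩ := hC
          refine Finset.sum_lt_sum (fun i _ => ?_) ⟨j, Finset.mem_univ _, ?_⟩
          · by_cases hi : i ∈ C
            · have := hA'fst y i hi
              omega
            · simp [A', hi]
          · have := hA'fst y j hj
            omega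
        · by_cases hi : i ∈ C
          · refine (Bundled.bound_le_value _ _).trans ?_
            simp [β, hi, hA'fst y i hi]
          · simp [A', β, hi]
    _ = ∏ i, ∑ y, β i y := by
        rw [Finset.prod_univ_sum, Fintype.piFinset_univ]
    _ ≤ ∏ i, (A i).bound (W i) := Finset.prod_le_prod' fun i _ => hβ i

/-- **Direct product theorem for memoryless players.** Player `i` collects weight from its own
oracle but may query all of them; the players share nothing. The total weight is then at most
the product of the values of the single games. -/
theorem sum_prod_le_prod_bound [Nonempty B] [Nonempty O]
    (W : ι → (Q → B) → O → ℝ≥0∞) (A : ι → Bundled (ι × Q) B O) :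
    ∑ g : ι → Q → B, ∏ i, W i (g i) ((A i).2.run fun q => g q.1 q.2)
      ≤ ∏ i, (A i).bound (W i) := by
  classical
  induction hn : ∑ i, (A i).1 using Nat.strong_induction_on generalizing W A with
  | _ n ihn =>
  have ih : ∀ (W' : ι → (Q → B) → O → ℝ≥0∞) (A' : ι → Bundled (ι × Q) B O),
      ∑ i, (A' i).1 < ∑ i, (A i).1 →
      ∑ g : ι → Q → B, ∏ i, W' i (g i) ((A' i).2.run fun q => g q.1 q.2)
        ≤ ∏ i, (A' i).bound (W' i) :=
    fun W' A' h => ihn _ (hn ▸ h) W' A' rfl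
  by_cases hret : ∃ j i q, (A j).head = some (i, q) ∧ (A i).head = none
  · obtain ⟨j, i, q, hj, hi⟩ := hret
    exact sum_prod_le_of_reveal W A {j} {i} (fun _ => q) (fun _ => i) (by simpa using hj)
      (by simp) (by simpa using fun _ => hi) ⟨j, rfl⟩ ih
  · push Not at hret
    by_cases hact : ∃ j, (A j).head ≠ none
    · obtain ⟨j₀, hj₀⟩ := hact
      let Act := {i // (A i).head ≠ none}
      have htarget : ∀ i : Act, ∃ t : Act × Q, (A i).head = some (t.1.1, t.2) := by
        rintro ⟨i, hi⟩
        obtain ⟨⟨k, q⟩, hk⟩ := Option.ne_none_iff_exists'.1 hi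
        exact ⟨(⟨k, hret i k q hk⟩, q), hk⟩
      choose t ht using htarget
      let τ : Act → Act := fun i => (t i).1
      obtain ⟨x, hx⟩ : ∃ x, x ∈ Function.periodicPts τ := by
        obtain ⟨m, n, hmn, h⟩ :=
          Finite.exists_ne_map_eq_of_infinite (fun n : ℕ => τ^[n] ⟨j₀, hj₀⟩)
        wlog hlt : m < n generalizing m n
        · exact this n m hmn.symm h.symm (by omega)
        refine ⟨τ^[m] ⟨j₀, hj₀⟩, n - m, by omega, ?_⟩
        rw [Function.IsPeriodicPt, Function.IsFixedPt, ← Function.iterate_add_apply,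
          Nat.sub_add_cancel hlt.le]
        exact h.symm
      have hbij := Function.bijOn_periodicPts τ
      have hq : Nonempty Q := ⟨(t x).2⟩
      let p : ι → Q := fun d =>
        if h : ∃ i ∈ Function.periodicPts τ, (τ i).1 = d then (t h.choose).2
        else Classical.arbitrary Q
      have hp : ∀ i ∈ Function.periodicPts τ, p (τ i).1 = (t i).2 := by
        intro i hi
        have h : ∃ i' ∈ Function.periodicPts τ, (τ i').1 = (τ i).1 := ⟨i, hi, rfl⟩
        have heq : h.choose = i :=
          hbij.injOn h.choose_spec.1 hi (Subtype.ext h.choose_spec.2)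
        simp only [p, dif_pos h, heq]
      let C : Set ι := Subtype.val '' Function.periodicPts τ
      let σ : ι → ι := fun i => if h : (A i).head ≠ none then (τ ⟨i, h⟩).1 else i
      have hσ : ∀ i : Act, σ i.1 = (τ i).1 := fun i => dif_pos i.2
      refine sum_prod_le_of_reveal W A C C p σ ?_ ?_ (fun i hi hi' => absurd hi hi')
        ⟨x.1, x, hx, rfl⟩ ih
      · rintro _ ⟨i, hi, rfl⟩
        rw [hσ, hp i hi]
        exact ht i
      · rintro _ ⟨i, hi, rfl⟩
        rw [hσ]
        exact ⟨τ i, hbij.mapsTo hi, rfl⟩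
    · push Not at hact
      have hout : ∀ i, ∃ o, (∀ f, (A i).2.run f = o) ∧ (A i).bound (W i) = ∑ f, W i f o := by
        intro i
        have hi := hact i
        generalize A i = Ai at hi
        rcases Ai with ⟨_, o | _⟩
        · exact ⟨o, fun f => rfl, rfl⟩
        · simp [Bundled.head] at hi
      choose o ho hb using hout
      simp only [ho, hb]
      rw [Finset.prod_univ_sum, Fintype.piFinset_univ]

theorem sum_prod_le_prod_value [Nonempty B] [Nonempty O]
    (W : ι → (Q → B) → O → ℝ≥0∞) {T : ℕ} (A : ι → DT (ι × Q) (fun _ => B) O T) :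
    ∑ g : ι → Q → B, ∏ i, W i (g i) ((A i).run fun q => g q.1 q.2)
      ≤ ∏ i, value (W i) T :=
  (sum_prod_le_prod_bound W fun i => ⟨T, A i⟩).trans
    (Finset.prod_le_prod' fun _ _ => Bundled.bound_le_value _ _)

end DT

theorem ind_le_one (p : Prop) : ind p ≤ 1 := by
  unfold ind
  split_ifs <;> simp

namespace Game

variable (G : Game)

theorem detWinProb_le_unifSec {T : ℕ}
    (a : G.Ch → DT (Fin G.M) (fun _ => Fin G.N) G.Out T) :
    G.detWinProb a ≤ G.unifSec T := by
  refine le_iSup_of_le (PMF.pure a) ?_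
  rw [tsum_eq_single a (fun b hb => by simp [PMF.pure_apply, hb])]
  simp

theorem sum_π (f : Fin G.M → Fin G.N) : ∑ ch, G.π f ch = 1 := by
  rw [← tsum_fintype (L := .unconditional _)]
  exact (G.π f).tsum_coe

theorem sum_μ : ∑ f, G.μ f = 1 := by
  rw [← tsum_fintype (L := .unconditional _)]
  exact G.μ.tsum_coe

theorem unifSec_le_one (T : ℕ) : G.unifSec T ≤ 1 := by
  refine iSup_le fun A => ?_
  have hdet : ∀ a, G.detWinProb (T := T) a ≤ 1 := fun a => by
    calc G.detWinProb a ≤ ∑ f, G.μ f * ∑ ch, G.π f ch * 1 := by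
          simp only [detWinProb, tsum_fintype]
          gcongr
          exact ind_le_one _
      _ = 1 := by simp [G.sum_π, G.sum_μ]
  calc ∑' a, A a * G.detWinProb a ≤ ∑' a, A a * 1 := by gcongr; exact hdet _
    _ = 1 := by simp [A.tsum_coe]

/-- The weight `1 + [win]` of an output on a given challenge. -/
noncomputable def weight (ch : G.Ch) (f : Fin G.M → Fin G.N) (o : G.Out) : ℝ≥0∞ :=
  G.μ f * (G.π f ch * (1 + ind (o ∈ G.R f ch)))

theorem sum_weight {T : ℕ} (a : G.Ch → DT (Fin G.M) (fun _ => Fin G.N) G.Out T) :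
    ∑ ch, ∑ f, G.weight ch f ((a ch).run f) = 1 + G.detWinProb a := by
  rw [Finset.sum_comm]
  simp only [weight, detWinProb, tsum_fintype, mul_add, mul_one, Finset.sum_add_distrib,
    Finset.mul_sum]
  simp only [← Finset.mul_sum, G.sum_π, mul_one, G.sum_μ]

theorem sum_value_weight_le [Nonempty G.Out] (T : ℕ) :
    ∑ ch, DT.value (G.weight ch) T ≤ 1 + G.unifSec T := by
  have : Nonempty (DT (Fin G.M) (fun _ => Fin G.N) G.Out T) :=
    ⟨DT.ret (Classical.arbitrary G.Out)⟩
  refine (DT.sum_iSup_le_iSup_sum _ _).trans (iSup_le fun a => ?_)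
  rw [G.sum_weight]
  exact add_le_add_right (G.detWinProb_le_unifSec a) _

/-- Probability of winning the salted game on joint oracle `g` and salt `k`. -/
noncomputable def saltWin {K T : ℕ}
    (a : Fin K → G.Ch → DT (Fin K × Fin G.M) (fun _ => Fin G.N) G.Out T)
    (g : Fin K → Fin G.M → Fin G.N) (k : Fin K) : ℝ≥0∞ :=
  ∑ ch, G.π (g k) ch * ind ((a k ch).run (fun q => g q.1 q.2) ∈ G.R (g k) ch)

theorem saltWin_le_one {K T : ℕ}
    (a : Fin K → G.Ch → DT (Fin K × Fin G.M) (fun _ => Fin G.N) G.Out T)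
    (g : Fin K → Fin G.M → Fin G.N) (k : Fin K) : G.saltWin a g k ≤ 1 := by
  calc G.saltWin a g k ≤ ∑ ch, G.π (g k) ch * 1 := by
        unfold saltWin
        gcongr
        exact ind_le_one _
    _ = 1 := by simp [G.sum_π]

theorem sum_prod_one_add_saltWin_le [Nonempty G.Out] {K T : ℕ}
    (a : Fin K → G.Ch → DT (Fin K × Fin G.M) (fun _ => Fin G.N) G.Out T) :
    ∑ g : Fin K → Fin G.M → Fin G.N, (∏ k, G.μ (g k)) * ∏ k, (1 + G.saltWin a g k)
      ≤ (1 + G.unifSec T) ^ K := by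
  classical
  have : Nonempty (Fin G.N) := ⟨⟨0, G.hN⟩⟩
  have hprod : ∀ g : Fin K → Fin G.M → Fin G.N,
      (∏ k, G.μ (g k)) * ∏ k, (1 + G.saltWin a g k) =
        ∑ c : Fin K → G.Ch, ∏ k, G.weight (c k) (g k)
          ((a k (c k)).run fun q => g q.1 q.2) := by
    intro g
    rw [← Fintype.piFinset_univ, ← Finset.prod_univ_sum (fun _ => Finset.univ)
      (fun k ch => G.weight ch (g k) ((a k ch).run fun q => g q.1 q.2)),
      ← Finset.prod_mul_distrib]
    refine Finset.prod_congr rfl fun k _ => ?_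
    simp only [weight, ← Finset.mul_sum, mul_add, mul_one, Finset.sum_add_distrib, G.sum_π,
      saltWin]
  calc _ = ∑ c : Fin K → G.Ch, ∑ g : Fin K → Fin G.M → Fin G.N,
        ∏ k, G.weight (c k) (g k) ((a k (c k)).run fun q => g q.1 q.2) := by
        rw [Finset.sum_comm]
        exact Finset.sum_congr rfl fun g _ => hprod g
    _ ≤ ∑ c : Fin K → G.Ch, ∏ k, DT.value (G.weight (c k)) T :=
        Finset.sum_le_sum fun c _ =>
          DT.sum_prod_le_prod_value (fun k => G.weight (c k)) fun k => a k (c k)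
    _ = (∑ ch, DT.value (G.weight ch) T) ^ K := by
        rw [← Fintype.piFinset_univ,
          ← Finset.prod_univ_sum (fun _ => Finset.univ) (fun _ ch => DT.value (G.weight ch) T)]
        simp
    _ ≤ (1 + G.unifSec T) ^ K := by
        gcongr
        exact G.sum_value_weight_le T

end Game

theorem exp_half_le_one_add {x : ℝ} (h0 : 0 ≤ x) (h1 : x ≤ 1) : Real.exp (x / 2) ≤ 1 + x := by
  have h := Real.add_one_le_exp (-(x / 2))
  rw [Real.exp_neg] at h
  have hpos := Real.exp_pos (x / 2)
  have h2 : (-(x / 2) + 1) * Real.exp (x / 2) ≤ 1 := by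
    calc _ ≤ (Real.exp (x / 2))⁻¹ * Real.exp (x / 2) := by gcongr
      _ = 1 := inv_mul_cancel₀ hpos.ne'
  nlinarith [mul_nonneg h0 (sub_nonneg.2 h1)]

theorem sum_add_two_le {ι : Type} [Fintype ι] (x : ι → ℝ) (h0 : ∀ i, 0 ≤ x i)
    (h1 : ∀ i, x i ≤ 1) (a : ℝ) :
    ∑ i, x i + 2 ≤ 2 * a + 2 * (Real.exp (-a) * ∏ i, (1 + x i)) := by
  have hexp : Real.exp ((∑ i, x i) / 2) ≤ ∏ i, (1 + x i) := by
    rw [Finset.sum_div, Real.exp_sum]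
    exact Finset.prod_le_prod (fun i _ => (Real.exp_pos _).le)
      fun i _ => exp_half_le_one_add (h0 i) (h1 i)
  have h := Real.add_one_le_exp ((∑ i, x i) / 2 + -a)
  rw [Real.exp_add, mul_comm] at h
  have := mul_le_mul_of_nonneg_left hexp (Real.exp_pos (-a)).le
  linarith

theorem ENNReal.sum_add_two_le {ι : Type} [Fintype ι] (X : ι → ℝ≥0∞) (h1 : ∀ i, X i ≤ 1)
    {a : ℝ} (ha : 0 ≤ a) :
    ∑ i, X i + 2 ≤
      2 * ENNReal.ofReal a + 2 * (ENNReal.ofReal (Real.exp (-a)) * ∏ i, (1 + X i)) := by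
  have hX : ∀ i, X i = ENNReal.ofReal (X i).toReal := fun i =>
    (ENNReal.ofReal_toReal ((h1 i).trans_lt ENNReal.one_lt_top).ne).symm
  have h := _root_.sum_add_two_le (fun i => (X i).toReal) (fun _ => ENNReal.toReal_nonneg)
    (fun i => ENNReal.toReal_le_of_le_ofReal zero_le_one (by simpa using h1 i)) a
  have hprod : ∏ i, (1 + X i) = ENNReal.ofReal (∏ i, (1 + (X i).toReal)) := by
    rw [ENNReal.ofReal_prod_of_nonneg fun i _ => by positivity]
    refine Finset.prod_congr rfl fun i _ => ?_
    rw [ENNReal.ofReal_add zero_le_one ENNReal.toReal_nonneg, ← hX, ENNReal.ofReal_one]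
  have hsum : ∑ i, X i = ENNReal.ofReal (∑ i, (X i).toReal) := by
    rw [ENNReal.ofReal_sum_of_nonneg fun i _ => ENNReal.toReal_nonneg]
    exact Finset.sum_congr rfl fun i _ => hX i
  have htwo : (2 : ℝ≥0∞) = ENNReal.ofReal 2 := by simp
  rw [hprod, hsum, htwo, ← ENNReal.ofReal_mul (Real.exp_pos _).le,
    ← ENNReal.ofReal_mul zero_le_two, ← ENNReal.ofReal_mul zero_le_two,
    ← ENNReal.ofReal_add (Finset.sum_nonneg fun _ _ => ENNReal.toReal_nonneg) zero_le_two,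
    ← ENNReal.ofReal_add (by positivity) (by positivity)]
  exact ENNReal.ofReal_le_ofReal h

namespace Game

variable (G : Game)

theorem sum_prod_μ (K : ℕ) :
    ∑ g : Fin K → Fin G.M → Fin G.N, ∏ k, G.μ (g k) = 1 := by
  classical
  rw [← Fintype.piFinset_univ, ← Finset.prod_univ_sum (fun _ => Finset.univ) (fun _ f => G.μ f)]
  simp [G.sum_μ]

theorem sum_saltWin_le [Nonempty G.Out] {K S T : ℕ}
    (a : (Fin S → Bool) → Fin K → G.Ch → DT (Fin K × Fin G.M) (fun _ => Fin G.N) G.Out T)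
    (adv : (Fin K → Fin G.M → Fin G.N) → Fin S → Bool) :
    ∑ g : Fin K → Fin G.M → Fin G.N, (∏ k, G.μ (g k)) * ∑ k, G.saltWin (a (adv g)) g k
      ≤ 2 * (S + G.unifSec T * K) := by
  classical
  have hε : G.unifSec T ≠ ⊤ := ((G.unifSec_le_one T).trans_lt ENNReal.one_lt_top).ne
  set e := (G.unifSec T).toReal with he
  have he0 : 0 ≤ e := ENNReal.toReal_nonneg
  have hεe : G.unifSec T = ENNReal.ofReal e := (ENNReal.ofReal_toReal hε).symm
  set b : ℝ := S + e * K with hb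
  have hb0 : 0 ≤ b := by positivity
  have hbE : ENNReal.ofReal b = S + G.unifSec T * K := by
    rw [hb, ENNReal.ofReal_add (by positivity) (by positivity), ENNReal.ofReal_mul he0, hεe]
    simp
  have hadvice : ∑ g : Fin K → Fin G.M → Fin G.N,
      (∏ k, G.μ (g k)) * ∏ k, (1 + G.saltWin (a (adv g)) g k)
        ≤ 2 ^ S * (1 + G.unifSec T) ^ K := by
    calc _ ≤ ∑ g : Fin K → Fin G.M → Fin G.N, ∑ s : Fin S → Bool,
          (∏ k, G.μ (g k)) * ∏ k, (1 + G.saltWin (a s) g k) :=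
          Finset.sum_le_sum fun g _ => Finset.single_le_sum
            (f := fun s => (∏ k, G.μ (g k)) * ∏ k, (1 + G.saltWin (a s) g k))
            (fun _ _ => zero_le) (Finset.mem_univ (adv g))
      _ ≤ ∑ s : Fin S → Bool, (1 + G.unifSec T) ^ K := by
          rw [Finset.sum_comm]
          exact Finset.sum_le_sum fun s _ => G.sum_prod_one_add_saltWin_le (a s)
      _ = 2 ^ S * (1 + G.unifSec T) ^ K := by simp
  have hexp : ENNReal.ofReal (Real.exp (-b)) * (2 ^ S * (1 + G.unifSec T) ^ K) ≤ 1 := by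
    have h2 : (2 : ℝ) ^ S ≤ Real.exp S := by
      rw [← Real.exp_one_pow]
      gcongr
      linarith [Real.add_one_le_exp (1 : ℝ)]
    have h3 : (1 + e) ^ K ≤ Real.exp (e * K) := by
      rw [mul_comm, Real.exp_nat_mul]
      gcongr
      linarith [Real.add_one_le_exp e]
    have hr : Real.exp (-b) * (2 ^ S * (1 + e) ^ K) ≤ 1 := by
      calc _ ≤ Real.exp (-b) * (Real.exp S * Real.exp (e * K)) := by gcongr
        _ = 1 := by rw [← Real.exp_add, ← Real.exp_add, hb]; simp
    have hcast : (2 : ℝ≥0∞) ^ S * (1 + G.unifSec T) ^ K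
        = ENNReal.ofReal (2 ^ S * (1 + e) ^ K) := by
      rw [ENNReal.ofReal_mul (by positivity), ENNReal.ofReal_pow zero_le_two,
        ENNReal.ofReal_pow (by positivity), ENNReal.ofReal_add zero_le_one he0, hεe]
      simp
    rw [hcast, ← ENNReal.ofReal_mul (Real.exp_pos _).le]
    exact ENNReal.ofReal_le_one.2 hr
  rw [← hbE]
  refine (ENNReal.add_le_add_iff_right (a := 2) (by simp)).1 ?_
  calc _ = ∑ g : Fin K → Fin G.M → Fin G.N,
        (∏ k, G.μ (g k)) * (∑ k, G.saltWin (a (adv g)) g k + 2) := by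
        simp only [mul_add, Finset.sum_add_distrib, ← Finset.sum_mul, G.sum_prod_μ, one_mul]
    _ ≤ ∑ g : Fin K → Fin G.M → Fin G.N, (∏ k, G.μ (g k)) * (2 * ENNReal.ofReal b +
        2 * (ENNReal.ofReal (Real.exp (-b)) * ∏ k, (1 + G.saltWin (a (adv g)) g k))) := by
        refine Finset.sum_le_sum fun g _ => mul_le_mul_right ?_ _
        exact ENNReal.sum_add_two_le _ (G.saltWin_le_one _ g) hb0
    _ = 2 * ENNReal.ofReal b + 2 * (ENNReal.ofReal (Real.exp (-b)) *
        ∑ g : Fin K → Fin G.M → Fin G.N,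
          (∏ k, G.μ (g k)) * ∏ k, (1 + G.saltWin (a (adv g)) g k)) := by
        simp only [mul_add, Finset.sum_add_distrib, ← Finset.sum_mul, G.sum_prod_μ, one_mul,
          Finset.mul_sum]
        congr 1
        exact Finset.sum_congr rfl fun g _ => by ring
    _ ≤ 2 * ENNReal.ofReal b + 2 * 1 := by
        gcongr
        exact (mul_le_mul_right hadvice _).trans hexp
    _ = 2 * ENNReal.ofReal b + 2 := by rw [mul_one]

theorem saltedWinProb_eq_tsum (K S T : ℕ)
    (A : PMF ((Fin S → Bool) × Fin K × G.Ch →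
      DT (Fin K × Fin G.M) (fun _ => Fin G.N) G.Out T))
    (adv : (Fin K → Fin G.M → Fin G.N) → Fin S → Bool) :
    G.saltedWinProb K S T A adv =
      ∑' a, A a * ((K : ℝ≥0∞)⁻¹ * ∑ g : Fin K → Fin G.M → Fin G.N,
        (∏ k, G.μ (g k)) * ∑ k, G.saltWin (fun k ch => a (adv g, k, ch)) g k) := by
  simp only [saltedWinProb, saltWin, tsum_fintype, Finset.mul_sum, ← ENNReal.tsum_mul_left]
  rw [Summable.tsum_finsetSum fun _ _ => ENNReal.summable]
  refine Finset.sum_congr rfl fun g _ => ?_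
  rw [Summable.tsum_finsetSum fun _ _ => ENNReal.summable]
  refine Finset.sum_congr rfl fun k _ => ?_
  rw [Summable.tsum_finsetSum fun _ _ => ENNReal.summable]
  exact Finset.sum_congr rfl fun ch _ => tsum_congr fun a => by ring

theorem nonempty_out {K S T : ℕ} (hK : 0 < K)
    (a : (Fin S → Bool) × Fin K × G.Ch →
      DT (Fin K × Fin G.M) (fun _ => Fin G.N) G.Out T) : Nonempty G.Out := by
  obtain ⟨ch, _⟩ := (G.π fun _ => ⟨0, G.hN⟩).support_nonempty
  exact ⟨(a (fun _ => false, ⟨0, hK⟩, ch)).run fun _ => ⟨0, G.hN⟩⟩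

end Game

/-- Multiplicative bound: for every game `G`, every `K ∈ ℤ+` and all
`S, T ∈ ℕ`, `ε_{G_K}(S, T) ≤ 2·ε_G(T) + 2S/K`. -/
theorem salted_nonuniform_le_mult (G : Game) (K : ℕ) (hK : 0 < K) (S T : ℕ) :
    G.saltedNonunifSec K S T ≤
      2 * G.unifSec T + 2 * (S : ℝ≥0∞) / (K : ℝ≥0∞) := by
  have hK0 : (K : ℝ≥0∞) ≠ 0 := by exact_mod_cast hK.ne'
  refine iSup₂_le fun A adv => ?_
  rw [G.saltedWinProb_eq_tsum]
  calc _ ≤ ∑' a, A a * ((K : ℝ≥0∞)⁻¹ * (2 * (S + G.unifSec T * K))) := by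
        gcongr with a
        have := G.nonempty_out hK a
        exact G.sum_saltWin_le (fun s k ch => a (s, k, ch)) adv
    _ = (K : ℝ≥0∞)⁻¹ * (2 * (S + G.unifSec T * K)) := by
        rw [ENNReal.tsum_mul_right, A.tsum_coe, one_mul]
    _ = 2 * G.unifSec T * (K * (K : ℝ≥0∞)⁻¹) + 2 * (S : ℝ≥0∞) / K := by
        rw [div_eq_mul_inv]
        ring
    _ = 2 * G.unifSec T + 2 * (S : ℝ≥0∞) / K := by
        rw [ENNReal.mul_inv_cancel hK0 (ENNReal.natCast_ne_top K), mul_one]
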